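/- Let τ₁, τ₂ ∈ ℂ with Im τ₁ ≠ 0 and Im τ₂ ≠ 0. Suppose (k₁⁽¹⁾, k₂⁽¹⁾, k₃⁽¹⁾, k₄⁽¹⁾) and (k₁⁽²⁾, k₂⁽²⁾, k₃⁽²⁾, k₄⁽²⁾) are two vectors in ℚ⁴ that are linearly independent over ℚ, and that for j = 1, 2 one has k₁⁽ʲ⁾ + k₂⁽ʲ⁾·conj(τ₂) + k₃⁽ʲ⁾·τ₁ + k₄⁽ʲ⁾·τ₁·conj(τ₂) = 0. Then the subfields ℚ(τ₁) and ℚ(τ₂) of ℂ are equal, and [ℚ(τ₁) : ℚ] = 2. -/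

import Mathlib

open ComplexConjugate

/-- A non-real complex number satisfies no nontrivial linear relation over `ℚ`. -/
theorem Complex.eq_zero_of_rat_add_rat_mul_eq_zero {z : ℂ} (hz : z.im ≠ 0) {p q : ℚ}
    (h : (p : ℂ) + q * z = 0) : p = 0 ∧ q = 0 := by
  have hq : q = 0 := by
    have him := congrArg Complex.im h
    simpa [hz] using him
  subst hq
  exact ⟨by simpa using h, rfl⟩

/-- A non-real root of a rational quadratic generates a quadratic extension of `ℚ`. -/
theorem Complex.finrank_adjoin_eq_two_of_quadratic {z : ℂ} (hz : z.im ≠ 0) {A B C : ℚ}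
    (hA : A ≠ 0) (h : (A : ℂ) * z ^ 2 + B * z + C = 0) :
    Module.finrank ℚ (IntermediateField.adjoin ℚ ({z} : Set ℂ)) = 2 := by
  set P : Polynomial ℚ :=
    Polynomial.C A * Polynomial.X ^ 2 + Polynomial.C B * Polynomial.X + Polynomial.C C with hP
  have hdeg : P.natDegree = 2 := Polynomial.natDegree_quadratic hA
  have hP0 : P ≠ 0 := by
    intro h0
    simp [h0] at hdeg
  have hroot : Polynomial.aeval z P = 0 := by
    simpa [hP] using h
  have hint : IsIntegral ℚ z := IsAlgebraic.isIntegral ⟨P, hP0, hroot⟩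
  rw [IntermediateField.adjoin.finrank hint]
  apply le_antisymm
  · rw [← hdeg]
    exact Polynomial.natDegree_le_of_dvd (minpoly.dvd ℚ z hroot) hP0
  · rw [minpoly.two_le_natDegree_iff hint]
    rintro ⟨q, rfl⟩
    simp at hz

/-- A rational Möbius image of a non-real number lies in the field which that number generates. -/
theorem Complex.mem_adjoin_of_bilinear_relation {t w : ℂ} (hw : w.im ≠ 0) {a b c d : ℚ}
    (hcd : ¬(c = 0 ∧ d = 0)) (h : (a : ℂ) + b * w + c * t + d * t * w = 0) :
    t ∈ IntermediateField.adjoin ℚ ({w} : Set ℂ) := by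
  have hne : (c : ℂ) + d * w ≠ 0 := fun h0 =>
    hcd (Complex.eq_zero_of_rat_add_rat_mul_eq_zero hw h0)
  have ht : t = -(a + b * w) / (c + d * w) := by
    rw [eq_div_iff hne]
    linear_combination h
  have hmem := IntermediateField.mem_adjoin_simple_self ℚ w
  have hrat (q : ℚ) : (q : ℂ) ∈ IntermediateField.adjoin ℚ ({w} : Set ℂ) :=
    IntermediateField.algebraMap_mem _ q
  rw [ht]
  exact div_mem (neg_mem (add_mem (hrat a) (mul_mem (hrat b) hmem)))
    (add_mem (hrat c) (mul_mem (hrat d) hmem))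

/-- The conjugate of a non-real root of a rational quadratic generates the same field. -/
theorem Complex.adjoin_conj_eq_of_quadratic {z : ℂ} (hz : z.im ≠ 0) {A B C : ℚ}
    (hA : A ≠ 0) (h : (A : ℂ) * z ^ 2 + B * z + C = 0) :
    IntermediateField.adjoin ℚ ({conj z} : Set ℂ) = IntermediateField.adjoin ℚ ({z} : Set ℂ) := by
  have hconj : (A : ℂ) * conj z ^ 2 + B * conj z + C = 0 := by
    simpa using congrArg conj h
  have hne : z - conj z ≠ 0 := fun h0 =>
    hz (Complex.conj_eq_iff_im.mp (sub_eq_zero.mp h0).symm)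
  have hsum : (B : ℂ) + A * z + A * conj z + (0 : ℚ) * conj z * z = 0 := by
    apply mul_left_cancel₀ hne
    push_cast
    linear_combination h - hconj
  have hzc : (conj z).im ≠ 0 := by simpa using hz
  apply le_antisymm <;> rw [IntermediateField.adjoin_simple_le_iff]
  · exact mem_adjoin_of_bilinear_relation hz (fun h0 => hA h0.1) hsum
  · refine mem_adjoin_of_bilinear_relation (a := B) (b := A) (c := A) (d := 0) hzc
      (fun h0 => hA h0.1) ?_
    linear_combination hsum

/-- A bilinear relation between non-real numbers is given by an invertible matrix. -/
theorem Complex.eq_zero_of_bilinear_relation_of_det_eq_zero {t w : ℂ} (ht : t.im ≠ 0)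
    (hw : w.im ≠ 0) {a b c d : ℚ} (h : (a : ℂ) + b * w + c * t + d * t * w = 0)
    (hdet : a * d - b * c = 0) : a = 0 ∧ b = 0 ∧ c = 0 ∧ d = 0 := by
  have hdet' : (a : ℂ) * d - b * c = 0 := by exact_mod_cast hdet
  have hprod : ((b : ℂ) + d * t) * (c + d * w) = 0 := by
    linear_combination (d : ℂ) * h - hdet'
  have hd : d = 0 := by
    rcases mul_eq_zero.mp hprod with h0 | h0
    · exact (eq_zero_of_rat_add_rat_mul_eq_zero ht h0).2
    · exact (eq_zero_of_rat_add_rat_mul_eq_zero hw h0).2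
  subst hd
  have hbc : b = 0 ∨ c = 0 := by simpa using hdet
  rcases hbc with rfl | rfl
  · obtain ⟨ha, hc⟩ := eq_zero_of_rat_add_rat_mul_eq_zero (p := a) (q := c) ht (by simpa using h)
    exact ⟨ha, rfl, hc, rfl⟩
  · obtain ⟨ha, hb⟩ := eq_zero_of_rat_add_rat_mul_eq_zero (p := a) (q := b) hw (by simpa using h)
    exact ⟨ha, hb, rfl, rfl⟩

theorem stmt5 (τ₁ τ₂ : ℂ) (hτ₁ : τ₁.im ≠ 0) (hτ₂ : τ₂.im ≠ 0)
    (k : Fin 2 → Fin 4 → ℚ) (hk : LinearIndependent ℚ k)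
    (hrel : ∀ j : Fin 2,
      (k j 0 : ℂ) + (k j 1 : ℂ) * conj τ₂ + (k j 2 : ℂ) * τ₁ +
        (k j 3 : ℂ) * τ₁ * conj τ₂ = 0) :
    IntermediateField.adjoin ℚ ({τ₁} : Set ℂ) = IntermediateField.adjoin ℚ ({τ₂} : Set ℂ) ∧
      Module.finrank ℚ (IntermediateField.adjoin ℚ ({τ₁} : Set ℂ)) = 2 := by
  have hw : (conj τ₂).im ≠ 0 := by simpa using hτ₂
  have hdet : k 0 0 * k 0 3 - k 0 1 * k 0 2 ≠ 0 := by
    intro h0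
    obtain ⟨h0, h1, h2, h3⟩ :=
      Complex.eq_zero_of_bilinear_relation_of_det_eq_zero hτ₁ hw (hrel 0) h0
    apply hk.ne_zero 0
    ext i
    fin_cases i <;> assumption
  have hrel₀ := hrel 0
  have hrel₁ := hrel 1
  obtain ⟨A, hA⟩ : ∃ A, A = k 0 1 * k 1 3 - k 1 1 * k 0 3 := ⟨_, rfl⟩
  obtain ⟨B, hB⟩ : ∃ B, B = k 0 0 * k 1 3 + k 0 1 * k 1 2 - k 1 0 * k 0 3 - k 1 1 * k 0 2 :=
    ⟨_, rfl⟩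
  obtain ⟨C, hC⟩ : ∃ C, C = k 0 0 * k 1 2 - k 1 0 * k 0 2 := ⟨_, rfl⟩
  have hquad : (A : ℂ) * conj τ₂ ^ 2 + B * conj τ₂ + C = 0 := by
    rw [hA, hB, hC]
    push_cast
    linear_combination (k 1 2 + k 1 3 * conj τ₂) * hrel₀ - (k 0 2 + k 0 3 * conj τ₂) * hrel₁
  have hA0 : A ≠ 0 := by
    intro h0
    obtain ⟨hC0, hB0⟩ := Complex.eq_zero_of_rat_add_rat_mul_eq_zero (p := C) (q := B) hw (by
      rw [h0] at hquad
      push_cast at hquad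
      linear_combination hquad)
    rw [h0] at hA
    rw [hB0] at hB
    rw [hC0] at hC
    have hpair : LinearIndependent ℚ ![k 0, k 1] := by
      convert hk using 1
      ext i j
      fin_cases i <;> rfl
    refine hdet (neg_eq_zero.mp (LinearIndependent.pair_iff.mp hpair
      (k 1 0 * k 0 3 - k 0 1 * k 1 2) (-(k 0 0 * k 0 3 - k 0 1 * k 0 2)) ?_).2)
    ext i
    fin_cases i <;> simp
    · linear_combination k 0 1 * hC
    · linear_combination k 0 1 * hB - k 0 0 * hA
    · linear_combination k 0 3 * hC
    · linear_combination k 0 3 * hB - k 0 2 * hA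
  have hquad₂ : (A : ℂ) * τ₂ ^ 2 + B * τ₂ + C = 0 := by
    simpa using congrArg conj hquad
  have hfield : IntermediateField.adjoin ℚ ({τ₁} : Set ℂ) =
      IntermediateField.adjoin ℚ ({τ₂} : Set ℂ) := by
    rw [← Complex.adjoin_conj_eq_of_quadratic hτ₂ hA0 hquad₂]
    apply le_antisymm <;> rw [IntermediateField.adjoin_simple_le_iff]
    · refine Complex.mem_adjoin_of_bilinear_relation hw (fun h0 => hdet ?_) hrel₀
      rw [h0.1, h0.2]
      ring
    · refine Complex.mem_adjoin_of_bilinear_relation (a := k 0 0) (b := k 0 2) (c := k 0 1)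
        (d := k 0 3) hτ₁ (fun h0 => hdet ?_) ?_
      · rw [h0.1, h0.2]
        ring
      · linear_combination hrel₀
  exact ⟨hfield, hfield ▸ Complex.finrank_adjoin_eq_two_of_quadratic hτ₂ hA0 hquad₂⟩
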